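/- arXiv:math/0411218 — 2 statements merged into one kernel-verified Lean document; each statement's English description precedes it below -/
import Mathlib

section
/- The set of characteristic vectors K in L (i.e. K ∈ ℤ^14 with ⟨K,x⟩ ≡ ⟨x,x⟩ (mod 2) for all x ∈ L) satisfying all of the following conditions is exactly {K_X, −K_X}, where K_X = −2A − 2B + E_1 + E_2 + ⋯ + E_12: (i) the tuple (⟨K,R_0⟩, ⟨K,R_1⟩, ⟨K,R_2⟩, ⟨K,R_3⟩, ⟨K,R_4⟩, ⟨K,R_5⟩) is one of the seven tuples (7,0,0,0,0,0), (−1,0,−2,0,0,0), (5,0,0,0,0,−2), (−3,−2,0,0,0,0), (3,0,0,0,−2,0), (−7,0,0,0,0,0), (1,0,0,−2,0,0); (ii) for each i = 1,…,8, |⟨K,S_i⟩| ≤ −⟨S_i,S_i⟩ and ⟨K,S_i⟩ ≡ ⟨S_i,S_i⟩ (mod 2); (iii) ⟨K,K⟩ ≥ −4; (iv) ⟨K,H⟩ and ⟨K,A+B⟩ are both nonzero and have opposite signs. -/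
/-!  The lattice `L = ℤ¹⁴` with the intersection form of `(S²×S²) # 12 ℂP²bar`,
coordinates with respect to the basis `A, B, E₁, …, E₁₂`, and the vectors from
Ozsváth–Szabó's analysis of Park's manifold `P`. -/

namespace ParkP

abbrev L : Type := Fin 14 → ℤ
abbrev LQ : Type := Fin 14 → ℚ

/-- The intersection form: `⟨A,B⟩ = 1`, `⟨A,A⟩ = ⟨B,B⟩ = 0`, `⟨Eᵢ,Eⱼ⟩ = -δᵢⱼ`,
`⟨A,Eᵢ⟩ = ⟨B,Eᵢ⟩ = 0`. -/
def form (x y : L) : ℤ :=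
  x 0 * y 1 + x 1 * y 0 - ∑ i : Fin 14, if 2 ≤ (i : ℕ) then x i * y i else 0

/-- The same form, extended `ℚ`-bilinearly to `L ⊗ ℚ = ℚ¹⁴`. -/
def formQ (x y : LQ) : ℚ :=
  x 0 * y 1 + x 1 * y 0 - ∑ i : Fin 14, if 2 ≤ (i : ℕ) then x i * y i else 0

/-- The natural inclusion `L → L ⊗ ℚ`. -/
def toQ (x : L) : LQ := fun i => (x i : ℚ)

def A : L := ![1,0,0,0,0,0,0,0,0,0,0,0,0,0]
def B : L := ![0,1,0,0,0,0,0,0,0,0,0,0,0,0]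

/-- `R₀ = 10A+8B−6E₁−4E₂−4E₃−4E₄−4E₅−4E₆−3E₇−4E₈−4E₉−2E₁₀−2E₁₁−2E₁₂` -/
def R0 : L := ![10,8,-6,-4,-4,-4,-4,-4,-3,-4,-4,-2,-2,-2]
/-- `R₁ = B−E₁−E₄` -/
def R1 : L := ![0,1,-1,0,0,-1,0,0,0,0,0,0,0,0]
/-- `R₂ = A−E₂−E₃` -/
def R2 : L := ![1,0,0,-1,-1,0,0,0,0,0,0,0,0,0]
/-- `R₃ = E₃−E₆` -/
def R3 : L := ![0,0,0,0,1,0,0,-1,0,0,0,0,0,0]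
/-- `R₄ = E₆−E₉` -/
def R4 : L := ![0,0,0,0,0,0,0,1,0,0,-1,0,0,0]
/-- `R₅ = E₄−E₇` -/
def R5 : L := ![0,0,0,0,0,1,0,0,-1,0,0,0,0,0]

def R : Fin 6 → L := ![R0, R1, R2, R3, R4, R5]

/-- `S₁ = E₅−E₈` -/
def S1 : L := ![0,0,0,0,0,0,1,0,0,-1,0,0,0,0]
/-- `S₂ = E₁₂−E₁₀` -/
def S2 : L := ![0,0,0,0,0,0,0,0,0,0,0,-1,0,1]
/-- `S₃ = E₁₁−E₁₂` -/
def S3 : L := ![0,0,0,0,0,0,0,0,0,0,0,0,1,-1]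
/-- `S₄ = A−E₁−E₁₁` -/
def S4 : L := ![1,0,-1,0,0,0,0,0,0,0,0,0,-1,0]
/-- `S₅ = A+B−E₁−E₂−E₅−E₈` -/
def S5 : L := ![1,1,-1,-1,0,0,-1,0,0,-1,0,0,0,0]
/-- `S₆ = −E₅+E₁₀+E₁₁` -/
def S6 : L := ![0,0,0,0,0,0,-1,0,0,0,0,1,1,0]
/-- `S₇ = 2E₇+2E₄−2A+E₁₁` -/
def S7 : L := ![-2,0,0,0,0,2,0,0,2,0,0,0,1,0]
/-- `S₈ = E₆+E₉+E₃−E₂−2E₅` -/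
def S8 : L := ![0,0,0,-1,1,0,-2,1,0,0,1,0,0,0]

def S : Fin 8 → L := ![S1, S2, S3, S4, S5, S6, S7, S8]

/-- The period point `H ∈ L ⊗ ℚ`. -/
def H : LQ := ![105,92,-67,-51,-41,-38,-36,-41,-38,-36,-41,-18,-18,-18]

/-- The canonical class `K_X = −2A−2B+E₁+⋯+E₁₂`. -/
def KX : L := ![-2,-2,1,1,1,1,1,1,1,1,1,1,1,1]

/-- `K` is characteristic: `⟨K,x⟩ ≡ ⟨x,x⟩ (mod 2)` for all `x ∈ L`. -/
def IsCharacteristic (K : L) : Prop := ∀ x : L, form K x ≡ form x x [ZMOD 2]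

/-- The period point `H`, which is integral, as an element of `L`. -/
def periodPoint : L := ![105,92,-67,-51,-41,-38,-36,-41,-38,-36,-41,-18,-18,-18]

lemma form_eq (x y : L) : form x y = x 0 * y 1 + x 1 * y 0 - (x 2 * y 2 + x 3 * y 3 + x 4 * y 4
    + x 5 * y 5 + x 6 * y 6 + x 7 * y 7 + x 8 * y 8 + x 9 * y 9 + x 10 * y 10 + x 11 * y 11
    + x 12 * y 12 + x 13 * y 13) := by
  rw [form, Fin.sum_univ_def]
  simp [List.finRange_succ]
  ring

lemma form_neg_left (x y : L) : form (-x) y = -form x y := by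
  simp only [form_eq, Pi.neg_apply]
  ring

lemma form_neg_neg (x y : L) : form (-x) (-y) = form x y := by
  simp only [form_eq, Pi.neg_apply]
  ring

lemma formQ_toQ (x y : L) : formQ (toQ x) (toQ y) = form x y := by
  simp only [formQ, toQ, form]
  push_cast
  rfl

lemma toQ_periodPoint : toQ periodPoint = H := by
  funext i
  fin_cases i <;> simp [toQ, periodPoint, H]

lemma formQ_H (K : L) : formQ (toQ K) H = form K periodPoint := by
  rw [← toQ_periodPoint, formQ_toQ]

lemma form_periodPoint (K : L) : form K periodPoint = 92 * K 0 + 105 * K 1 + 67 * K 2 + 51 * K 3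
    + 41 * K 4 + 38 * K 5 + 36 * K 6 + 41 * K 7 + 38 * K 8 + 36 * K 9 + 41 * K 10 + 18 * K 11
    + 18 * K 12 + 18 * K 13 := by
  simp [form_eq, periodPoint]
  ring

lemma form_A_add_B (K : L) : form K (A + B) = K 0 + K 1 := by
  simp [form_eq, A, B]

lemma form_R (K : L) : form K R0 = 8 * K 0 + 10 * K 1 + 6 * K 2 + 4 * K 3 + 4 * K 4 + 4 * K 5
      + 4 * K 6 + 4 * K 7 + 3 * K 8 + 4 * K 9 + 4 * K 10 + 2 * K 11 + 2 * K 12 + 2 * K 13 ∧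
    form K R1 = K 0 + K 2 + K 5 ∧ form K R2 = K 1 + K 3 + K 4 ∧ form K R3 = K 7 - K 4 ∧
    form K R4 = K 10 - K 7 ∧ form K R5 = K 8 - K 5 := by
  refine ⟨?_, ?_, ?_, ?_, ?_, ?_⟩ <;> simp [form_eq, R0, R1, R2, R3, R4, R5] <;> ring

lemma IsCharacteristic.neg {K : L} (hK : IsCharacteristic K) : IsCharacteristic (-K) := by
  intro x
  have h := hK x
  rw [form_neg_left]
  unfold Int.ModEq at *
  omega

lemma IsCharacteristic.even_zero {K : L} (hK : IsCharacteristic K) : K 0 % 2 = 0 := by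
  have h := hK B
  simp [form_eq, B, Int.ModEq] at h
  omega

lemma IsCharacteristic.even_one {K : L} (hK : IsCharacteristic K) : K 1 % 2 = 0 := by
  have h := hK A
  simp [form_eq, A, Int.ModEq] at h
  omega

lemma IsCharacteristic.odd {K : L} (hK : IsCharacteristic K) (i : Fin 14) (hi : 2 ≤ (i : ℕ)) :
    K i % 2 = 1 := by
  have h := hK (Pi.single i 1)
  fin_cases i <;> simp [form_eq, Int.ModEq] at h hi ⊢ <;> omega

lemma isCharacteristic_KX : IsCharacteristic KX := by
  intro x
  have hx (i : Fin 14) : ∃ m, x i * x i = x i + 2 * m := by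
    obtain ⟨m, hm⟩ := Int.even_mul_pred_self (x i)
    exact ⟨m, by linarith⟩
  choose m hm using hx
  simp [form_eq, KX, hm, Int.modEq_iff_dvd, mul_comm (x 1) (x 0)]
  omega

/-- Among odd integers, `m e² + q e` is least at `e = -(2k+1)` if `4km ≤ q ≤ 4(k+1)m`. -/
lemma quadratic_ge_of_odd {e : ℤ} (he : e % 2 = 1) (m q k : ℤ) (hl : 4 * k * m ≤ q := by norm_num)
    (hu : q ≤ 4 * (k + 1) * m := by norm_num) :
    m * (2 * k + 1) ^ 2 - q * (2 * k + 1) ≤ m * e ^ 2 + q * e := by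
  obtain ⟨j, rfl⟩ : ∃ j, e = 2 * j - (2 * k + 1) := ⟨(e + (2 * k + 1)) / 2, by omega⟩
  have h : 0 ≤ j * (2 * m * j + (q - 2 * m * (2 * k + 1))) := by
    rcases lt_trichotomy j 0 with h | rfl | h
    · exact mul_nonneg_of_nonpos_of_nonpos h.le (by nlinarith)
    · simp
    · exact mul_nonneg h.le (by nlinarith)
  linarith

/-- The pairs of positive even integers permitted by the Cauchy–Schwarz inequality. -/
lemma mem_of_quadratic_bound {a b : ℤ} (ha : a % 2 = 0) (hb : b % 2 = 0) (ha0 : 0 < a)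
    (hb0 : 0 < b) (h : (92 * a + 105 * b) ^ 2 < 18585 * (2 * (a * b) + 4)) :
    (a, b) ∈ ({(2, 2), (2, 4), (4, 2), (4, 4), (6, 4), (6, 6)} : Set (ℤ × ℤ)) := by
  have hab : a * b ≤ 50 := by nlinarith [sq_nonneg (92 * a - 105 * b)]
  have ha' : a ≤ 25 := by nlinarith [show 2 ≤ b by omega]
  have hb' : b ≤ 25 := by nlinarith [show 2 ≤ a by omega]
  simp only [Set.mem_insert_iff, Set.mem_singleton_iff, Prod.mk.injEq]
  interval_cases a <;> first | omega | (interval_cases b <;> omega)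

/-- A characteristic vector of square at least `-4` whose pairings with `H` and `A + B` are
negative and positive agrees with `-K_X`, except perhaps for the sign of one of the last three
coordinates. -/
lemma near_neg_KX {K : L} (hK : IsCharacteristic K) (hsq : -4 ≤ form K K)
    (hH : form K periodPoint < 0) (hAB : 0 < form K (A + B)) :
    K 0 = 2 ∧ K 1 = 2 ∧ K 2 = -1 ∧ K 3 = -1 ∧ K 4 = -1 ∧ K 5 = -1 ∧ K 6 = -1 ∧ K 7 = -1 ∧
      K 8 = -1 ∧ K 9 = -1 ∧ K 10 = -1 ∧ -1 ≤ K 11 ∧ -1 ≤ K 12 ∧ -1 ≤ K 13 ∧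
      K 11 + K 12 + K 13 ≤ -1 := by
  rw [form_periodPoint] at hH
  rw [form_A_add_B] at hAB
  rw [form_eq] at hsq
  have ha := hK.even_zero
  have hb := hK.even_one
  have o2 := hK.odd 2 (by decide)
  have o3 := hK.odd 3 (by decide)
  have o4 := hK.odd 4 (by decide)
  have o5 := hK.odd 5 (by decide)
  have o6 := hK.odd 6 (by decide)
  have o7 := hK.odd 7 (by decide)
  have o8 := hK.odd 8 (by decide)
  have o9 := hK.odd 9 (by decide)
  have o10 := hK.odd 10 (by decide)
  have o11 := hK.odd 11 (by decide)
  have o12 := hK.odd 12 (by decide)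
  have o13 := hK.odd 13 (by decide)
  have cauchy := Finset.sum_mul_sq_le_sq_mul_sq Finset.univ
    (![67, 51, 41, 38, 36, 41, 38, 36, 41, 18, 18, 18] : Fin 12 → ℤ)
    ![K 2, K 3, K 4, K 5, K 6, K 7, K 8, K 9, K 10, K 11, K 12, K 13]
  simp [Fin.sum_univ_succ] at cauchy
  generalize K 0 = a at *
  generalize K 1 = b at *
  generalize K 2 = e1 at *
  generalize K 3 = e2 at *
  generalize K 4 = e3 at *
  generalize K 5 = e4 at *
  generalize K 6 = e5 at *
  generalize K 7 = e6 at *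
  generalize K 8 = e7 at *
  generalize K 9 = e8 at *
  generalize K 10 = e9 at *
  generalize K 11 = e10 at *
  generalize K 12 = e11 at *
  generalize K 13 = e12 at *
  have hone {e : ℤ} (he : e % 2 = 1) : 1 ≤ e ^ 2 := by simpa using quadratic_ge_of_odd he 1 0 0
  have s1 := hone o2
  have s2 := hone o3
  have s3 := hone o4
  have s4 := hone o5
  have s5 := hone o6
  have s6 := hone o7
  have s7 := hone o8
  have s8 := hone o9
  have s9 := hone o10
  have s10 := hone o11
  have s11 := hone o12
  have s12 := hone o13
  have hab : 4 ≤ a * b := by linarith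
  have ha0 : 0 < a := by
    by_contra! h
    linarith [mul_nonpos_of_nonpos_of_nonneg h (show 0 ≤ b by omega)]
  have hb0 : 0 < b := by
    by_contra! h
    linarith [mul_nonpos_of_nonneg_of_nonpos (show 0 ≤ a by omega) h]
  have hquad : (92 * a + 105 * b) ^ 2 < 18585 * (2 * (a * b) + 4) := by
    refine lt_of_lt_of_le (sq_lt_sq' (b := -(67 * e1 + 51 * e2 + 41 * e3 + 38 * e4 + 36 * e5
      + 41 * e6 + 38 * e7 + 36 * e8 + 41 * e9 + 18 * e10 + 18 * e11 + 18 * e12)) ?_ ?_) ?_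
    · linarith only [hH, ha0, hb0]
    · linarith only [hH]
    · linarith only [cauchy, hsq]
  have hmem := mem_of_quadratic_bound ha hb ha0 hb0 hquad
  clear cauchy hquad
  simp only [Set.mem_insert_iff, Set.mem_singleton_iff, Prod.mk.injEq] at hmem
  rcases hmem with ⟨rfl, rfl⟩ | ⟨rfl, rfl⟩ | ⟨rfl, rfl⟩ | ⟨rfl, rfl⟩ | ⟨rfl, rfl⟩ | ⟨rfl, rfl⟩
  · have bound {e : ℤ} (he : e ^ 2 ≤ 1) : -1 ≤ e ∧ e ≤ 1 :=
      abs_le.mp ((sq_le_one_iff_abs_le_one e).mp he)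
    have b1 := bound (e := e1) (by linarith)
    have b2 := bound (e := e2) (by linarith)
    have b3 := bound (e := e3) (by linarith)
    have b4 := bound (e := e4) (by linarith)
    have b5 := bound (e := e5) (by linarith)
    have b6 := bound (e := e6) (by linarith)
    have b7 := bound (e := e7) (by linarith)
    have b8 := bound (e := e8) (by linarith)
    have b9 := bound (e := e9) (by linarith)
    have b10 := bound (e := e10) (by linarith)
    have b11 := bound (e := e11) (by linarith)
    have b12 := bound (e := e12) (by linarith)
    clear hsq s1 s2 s3 s4 s5 s6 s7 s8 s9 s10 s11 s12
    omega
  iterate 2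
    · linarith only [hsq, hH, quadratic_ge_of_odd o2 51 268 1, quadratic_ge_of_odd o3 51 204 1,
        quadratic_ge_of_odd o4 51 164 0, quadratic_ge_of_odd o5 51 152 0,
        quadratic_ge_of_odd o6 51 144 0, quadratic_ge_of_odd o7 51 164 0,
        quadratic_ge_of_odd o8 51 152 0, quadratic_ge_of_odd o9 51 144 0,
        quadratic_ge_of_odd o10 51 164 0, quadratic_ge_of_odd o11 51 72 0,
        quadratic_ge_of_odd o12 51 72 0, quadratic_ge_of_odd o13 51 72 0]
  · linarith only [hsq, hH, quadratic_ge_of_odd o2 41 268 1, quadratic_ge_of_odd o3 41 204 1,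
      quadratic_ge_of_odd o4 41 164 1, quadratic_ge_of_odd o5 41 152 0,
      quadratic_ge_of_odd o6 41 144 0, quadratic_ge_of_odd o7 41 164 1,
      quadratic_ge_of_odd o8 41 152 0, quadratic_ge_of_odd o9 41 144 0,
      quadratic_ge_of_odd o10 41 164 1, quadratic_ge_of_odd o11 41 72 0,
      quadratic_ge_of_odd o12 41 72 0, quadratic_ge_of_odd o13 41 72 0]
  · linarith only [hsq, hH, quadratic_ge_of_odd o2 38 268 1, quadratic_ge_of_odd o3 38 204 1,
      quadratic_ge_of_odd o4 38 164 1, quadratic_ge_of_odd o5 38 152 1,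
      quadratic_ge_of_odd o6 38 144 0, quadratic_ge_of_odd o7 38 164 1,
      quadratic_ge_of_odd o8 38 152 1, quadratic_ge_of_odd o9 38 144 0,
      quadratic_ge_of_odd o10 38 164 1, quadratic_ge_of_odd o11 38 72 0,
      quadratic_ge_of_odd o12 38 72 0, quadratic_ge_of_odd o13 38 72 0]
  · linarith only [hsq, hH, quadratic_ge_of_odd o2 36 268 1, quadratic_ge_of_odd o3 36 204 1,
      quadratic_ge_of_odd o4 36 164 1, quadratic_ge_of_odd o5 36 152 1,
      quadratic_ge_of_odd o6 36 144 1, quadratic_ge_of_odd o7 36 164 1,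
      quadratic_ge_of_odd o8 36 152 1, quadratic_ge_of_odd o9 36 144 1,
      quadratic_ge_of_odd o10 36 164 1, quadratic_ge_of_odd o11 36 72 0,
      quadratic_ge_of_odd o12 36 72 0, quadratic_ge_of_odd o13 36 72 0]

/-- the characteristic vectors satisfying conditions (i)–(iv) are
exactly `{K_X, −K_X}`. -/
theorem basic_classes_of_P :
    {K : L | IsCharacteristic K ∧
      (form K R0, form K R1, form K R2, form K R3, form K R4, form K R5) ∈
        ({(7,0,0,0,0,0), (-1,0,-2,0,0,0), (5,0,0,0,0,-2), (-3,-2,0,0,0,0),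
          (3,0,0,0,-2,0), (-7,0,0,0,0,0), (1,0,0,-2,0,0)} :
          Set (ℤ × ℤ × ℤ × ℤ × ℤ × ℤ)) ∧
      (∀ i : Fin 8, |form K (S i)| ≤ -form (S i) (S i) ∧
        form K (S i) ≡ form (S i) (S i) [ZMOD 2]) ∧
      form K K ≥ -4 ∧
      ((formQ (toQ K) H > 0 ∧ form K (A + B) < 0) ∨
        (formQ (toQ K) H < 0 ∧ form K (A + B) > 0))} = {KX, -KX} := by
  ext K
  simp only [Set.mem_ofPred_eq, Set.mem_insert_iff, Set.mem_singleton_iff, Prod.mk.injEq]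
  constructor
  · rintro ⟨hK, hR, -, hsq, hsign⟩
    obtain ⟨r0, r1, r2, r3, r4, r5⟩ := form_R K
    rw [r0, r1, r2, r3, r4, r5] at hR
    rw [formQ_H] at hsign
    rcases hsign with ⟨hH, hAB⟩ | ⟨hH, hAB⟩
    · left
      have near := near_neg_KX hK.neg (by rwa [form_neg_neg])
        (by rw [form_neg_left]; have : 0 < form K periodPoint := by exact_mod_cast hH
            omega)
        (by rw [form_neg_left]; omega)
      simp only [Pi.neg_apply] at near
      have o11 := hK.odd 11 (by decide)
      have o12 := hK.odd 12 (by decide)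
      have o13 := hK.odd 13 (by decide)
      funext i
      fin_cases i <;> simp [KX] <;> omega
    · right
      have near := near_neg_KX hK hsq (by exact_mod_cast hH) hAB
      have o11 := hK.odd 11 (by decide)
      have o12 := hK.odd 12 (by decide)
      have o13 := hK.odd 13 (by decide)
      funext i
      fin_cases i <;> simp [KX] <;> omega
  · rintro (rfl | rfl)
    · refine ⟨isCharacteristic_KX, by decide, by decide, by decide, ?_⟩
      left
      rw [formQ_H]
      exact ⟨by exact_mod_cast (by decide : (0 : ℤ) < form KX periodPoint), by decide⟩
    · refine ⟨isCharacteristic_KX.neg, by decide, by decide, by decide, ?_⟩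
      right
      rw [formQ_H]
      exact ⟨by exact_mod_cast (by decide : form (-KX) periodPoint < (0 : ℤ)), by decide⟩

end ParkP
end

section
/- The set of characteristic vectors K in L' (i.e. K ∈ ℤ^13 with ⟨K,x⟩ ≡ ⟨x,x⟩ (mod 2) for all x ∈ L') satisfying all of the following conditions is exactly {K_Q, −K_Q}, where K_Q = −2A − 2B + E_1 + E_2 + ⋯ + E_11: (i) the tuple (⟨K,R_0⟩, ⟨K,R_1⟩, ⟨K,R_2⟩, ⟨K,R_3⟩) is one of the five tuples (5,0,0,0), (−1,−2,0,0), (3,0,0,−2), (−5,0,0,0), (1,0,−2,0); (ii) for each i = 1,…,9, |⟨K,S_i⟩| ≤ −⟨S_i,S_i⟩ and ⟨K,S_i⟩ ≡ ⟨S_i,S_i⟩ (mod 2); (iii) ⟨K,K⟩ ≥ −3; (iv) ⟨K,H⟩ and ⟨K,A+B⟩ are both nonzero and have opposite signs. -/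
/-!  The lattice `L' = ℤ¹³` with the intersection form of `(S²×S²) # 11 ℂP²bar`,
coordinates with respect to the basis `A, B, E₁, …, E₁₁`, and the vectors from
Ozsváth–Szabó's analysis of Park's manifold `Q`. -/

namespace ParkQ

abbrev L' : Type := Fin 13 → ℤ
abbrev LQ' : Type := Fin 13 → ℚ

/-- The intersection form: `⟨A,B⟩ = 1`, `⟨A,A⟩ = ⟨B,B⟩ = 0`, `⟨Eᵢ,Eⱼ⟩ = -δᵢⱼ`,
`⟨A,Eᵢ⟩ = ⟨B,Eᵢ⟩ = 0`. -/
def form (x y : L') : ℤ :=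
  x 0 * y 1 + x 1 * y 0 - ∑ i : Fin 13, if 2 ≤ (i : ℕ) then x i * y i else 0

/-- The same form, extended `ℚ`-bilinearly to `L' ⊗ ℚ = ℚ¹³`. -/
def formQ (x y : LQ') : ℚ :=
  x 0 * y 1 + x 1 * y 0 - ∑ i : Fin 13, if 2 ≤ (i : ℕ) then x i * y i else 0

/-- The natural inclusion `L' → L' ⊗ ℚ`. -/
def toQ (x : L') : LQ' := fun i => (x i : ℚ)

def A : L' := ![1,0,0,0,0,0,0,0,0,0,0,0,0]
def B : L' := ![0,1,0,0,0,0,0,0,0,0,0,0,0]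

/-- `R₀ = 7A+6B−4E₁−3E₂−3E₃−3E₄−3E₅−3E₆−2E₇−3E₈−3E₉−2E₁₀−2E₁₁` -/
def R0 : L' := ![7,6,-4,-3,-3,-3,-3,-3,-2,-3,-3,-2,-2]
/-- `R₁ = E₄−E₇` -/
def R1 : L' := ![0,0,0,0,0,1,0,0,-1,0,0,0,0]
/-- `R₂ = B−E₁−E₄` -/
def R2 : L' := ![0,1,-1,0,0,-1,0,0,0,0,0,0,0]
/-- `R₃ = A−E₂−E₃` -/
def R3 : L' := ![1,0,0,-1,-1,0,0,0,0,0,0,0,0]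

def R : Fin 4 → L' := ![R0, R1, R2, R3]

/-- `S₁ = E₁₀−E₁₁` -/
def S1 : L' := ![0,0,0,0,0,0,0,0,0,0,0,1,-1]
/-- `S₂ = E₅−E₆` -/
def S2 : L' := ![0,0,0,0,0,0,1,-1,0,0,0,0,0]
/-- `S₃ = E₈−E₉` -/
def S3 : L' := ![0,0,0,0,0,0,0,0,0,1,-1,0,0]
/-- `S₄ = E₅−E₈` -/
def S4 : L' := ![0,0,0,0,0,0,1,0,0,-1,0,0,0]
/-- `S₅ = E₂−E₃` -/
def S5 : L' := ![0,0,0,1,-1,0,0,0,0,0,0,0,0]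
/-- `S₆ = A−E₁−E₁₀` -/
def S6 : L' := ![1,0,-1,0,0,0,0,0,0,0,0,-1,0]
/-- `S₇ = A+B−E₁−E₂−E₅−E₈` -/
def S7 : L' := ![1,1,-1,-1,0,0,-1,0,0,-1,0,0,0]
/-- `S₈ = 2A−2E₄−2E₇−E₁₁` -/
def S8 : L' := ![2,0,0,0,0,-2,0,0,-2,0,0,0,-1]
/-- `S₉ = 2A+2B−E₁−E₂−E₃−E₄−E₇−2E₅−E₆−E₁₀` -/
def S9 : L' := ![2,2,-1,-1,-1,-1,-2,-1,-1,0,0,-1,0]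

def S : Fin 9 → L' := ![S1, S2, S3, S4, S5, S6, S7, S8, S9]

/-- The period point `H ∈ L' ⊗ ℚ`. -/
def H : LQ' := ![229,226,-143,-113,-113,-86,-87,-87,-86,-87,-87,-58,-58]

/-- The canonical class `K_Q = −2A−2B+E₁+⋯+E₁₁`. -/
def KQ : L' := ![-2,-2,1,1,1,1,1,1,1,1,1,1,1]

/-- `K` is characteristic: `⟨K,x⟩ ≡ ⟨x,x⟩ (mod 2)` for all `x ∈ L'`. -/
def IsCharacteristic (K : L') : Prop := ∀ x : L', form K x ≡ form x x [ZMOD 2]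

lemma form_expand (x y : L') : form x y = x 0 * y 1 + x 1 * y 0 -
    (x 2 * y 2 + x 3 * y 3 + x 4 * y 4 + x 5 * y 5 + x 6 * y 6 + x 7 * y 7 + x 8 * y 8 +
      x 9 * y 9 + x 10 * y 10 + x 11 * y 11 + x 12 * y 12) := by
  simp [form, Fin.sum_univ_succ]
  ring

lemma form_neg_left (x y : L') : form (-x) y = -form x y := by
  simp only [form_expand, Pi.neg_apply]
  ring

lemma form_neg_right (x y : L') : form x (-y) = -form x y := by
  simp only [form_expand, Pi.neg_apply]
  ring

/-- The period point `H` as an integral vector. -/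
def HInt : L' := ![229, 226, -143, -113, -113, -86, -87, -87, -86, -87, -87, -58, -58]

lemma formQ_toQ_H (K : L') : formQ (toQ K) H = (form K HInt : ℤ) := by
  simp [form, formQ, toQ, H, HInt, Fin.sum_univ_succ]

lemma form_HInt (K : L') : form K HInt = 226 * K 0 + 229 * K 1 + (143 * K 2 + 113 * K 3 +
    113 * K 4 + 86 * K 5 + 87 * K 6 + 87 * K 7 + 86 * K 8 + 87 * K 9 + 87 * K 10 +
    58 * K 11 + 58 * K 12) := by
  simp [form_expand, HInt]
  ring

lemma form_A_add_B (K : L') : form K (A + B) = K 0 + K 1 := by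
  simp [form_expand, A, B]

lemma IsCharacteristic.neg {K : L'} (hK : IsCharacteristic K) : IsCharacteristic (-K) := by
  intro x
  have h := hK (-x)
  rwa [form_neg_right, form_neg_right, form_neg_left x x, neg_neg, ← form_neg_left] at h

lemma isCharacteristic_KQ : IsCharacteristic KQ := by
  intro x
  have even_sq_sub (i : Fin 13) : Even (x i * (x i - 1)) := Int.even_mul_pred_self _
  choose m hm using even_sq_sub
  refine Int.modEq_iff_dvd.mpr ⟨x 0 * x 1 + x 0 + x 1 - (m 2 + m 3 + m 4 + m 5 + m 6 + m 7 +
    m 8 + m 9 + m 10 + m 11 + m 12), ?_⟩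
  simp [form_expand, KQ]
  linear_combination -hm 2 - hm 3 - hm 4 - hm 5 - hm 6 - hm 7 - hm 8 - hm 9 - hm 10 -
    hm 11 - hm 12

lemma IsCharacteristic.even_zero {K : L'} (hK : IsCharacteristic K) : Even (K 0) := by
  have h := hK B
  simp [form_expand, B] at h
  exact Int.even_iff.mpr h

lemma IsCharacteristic.even_one {K : L'} (hK : IsCharacteristic K) : Even (K 1) := by
  have h := hK A
  simp [form_expand, A] at h
  exact Int.even_iff.mpr h

lemma IsCharacteristic.odd_of_two_le {K : L'} (hK : IsCharacteristic K) (i : Fin 13)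
    (hi : 2 ≤ (i : ℕ)) : Odd (K i) := by
  have h := hK (Pi.single i 1)
  have h0 : i ≠ 0 := by rintro rfl; simp at hi
  have h1 : i ≠ 1 := by rintro rfl; simp at hi
  have pairing (x : L') : form x (Pi.single i 1) = -x i := by
    rw [form, Finset.sum_eq_single i (fun j _ hj => by simp [hj]) (by simp)]
    simp [h0.symm, h1.symm, hi]
  rw [pairing, pairing, Pi.single_eq_same] at h
  rw [Int.odd_iff]
  have h' : (-K i) % 2 = (-1) % 2 := h
  omega

/-- The form is negative definite on the orthogonal complement of a positive combination of `H`
and `A + B`; this bounds the hyperbolic part of a class separating the two. -/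
lemma mul_lt_of_form_HInt_neg {K : L'} (h0 : 0 ≤ K 0) (h1 : 0 ≤ K 1)
    (hsq : -3 ≤ form K K) (hH : form K HInt < 0) : K 0 * K 1 < 26 := by
  have cauchy := Finset.sum_mul_sq_le_sq_mul_sq Finset.univ
    (![143, 113, 113, 86, 87, 87, 86, 87, 87, 58, 58] : Fin 11 → ℤ)
    ![K 2, K 3, K 4, K 5, K 6, K 7, K 8, K 9, K 10, K 11, K 12]
  simp [Fin.sum_univ_succ] at cauchy
  rw [form_expand] at hsq
  rw [form_HInt] at hH
  have hpow : (226 * K 0 + 229 * K 1) ^ 2 ≤ (-(143 * K 2 + 113 * K 3 +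
      113 * K 4 + 86 * K 5 + 87 * K 6 + 87 * K 7 + 86 * K 8 + 87 * K 9 + 87 * K 10 +
      58 * K 11 + 58 * K 12)) ^ 2 :=
    pow_le_pow_left₀ (by positivity) (by linarith) 2
  nlinarith [sq_nonneg (226 * K 0 - 229 * K 1)]

lemma one_le_sq_of_odd {e : ℤ} (he : Odd e) : 1 ≤ e * e := by
  have hne : e ≠ 0 := by rintro rfl; simp at he
  nlinarith [Int.one_le_abs hne, abs_mul_abs_self e]

lemma mul_nonneg_of_consecutive_odd {e c : ℤ} (he : Odd e) (hc : Odd c) :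
    0 ≤ (e + c) * (e + c + 2) := by
  obtain ⟨k, rfl⟩ := he
  obtain ⟨l, rfl⟩ := hc
  rcases le_or_gt 0 (k + l + 1) with h | h
  · exact mul_nonneg (by omega) (by omega)
  · exact mul_nonneg_of_nonpos_of_nonpos (by omega) (by omega)

/-- A characteristic vector of square at least `-3` which is positive on `A + B` and negative
on `H` is `-K_Q`. -/
lemma eq_neg_KQ_of_separating {K : L'} (hK : IsCharacteristic K) (hsq : -3 ≤ form K K)
    (hH : form K HInt < 0) (hAB : 0 < K 0 + K 1) : K = -KQ := by
  obtain ⟨a, ha⟩ := hK.even_zero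
  obtain ⟨b, hb⟩ := hK.even_one
  have sq_pos (i : Fin 13) (hi : 2 ≤ (i : ℕ)) : 1 ≤ K i * K i :=
    one_le_sq_of_odd (hK.odd_of_two_le i hi)
  have hodd (i : Fin 13) (hi : 2 ≤ (i : ℕ)) := hK.odd_of_two_le i hi
  have near (i : Fin 13) (hi : 2 ≤ (i : ℕ)) : 0 ≤ (K i + 1) * (K i + 1 + 2) :=
    mul_nonneg_of_consecutive_odd (hodd i hi) odd_one
  have far (i : Fin 13) (hi : 2 ≤ (i : ℕ)) : 0 ≤ (K i + 3) * (K i + 3 + 2) :=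
    mul_nonneg_of_consecutive_odd (hodd i hi) (by decide)
  have p2 := sq_pos 2 (by decide)
  have p3 := sq_pos 3 (by decide)
  have p4 := sq_pos 4 (by decide)
  have p5 := sq_pos 5 (by decide)
  have p6 := sq_pos 6 (by decide)
  have p7 := sq_pos 7 (by decide)
  have p8 := sq_pos 8 (by decide)
  have p9 := sq_pos 9 (by decide)
  have p10 := sq_pos 10 (by decide)
  have p11 := sq_pos 11 (by decide)
  have p12 := sq_pos 12 (by decide)
  have hform := form_expand K K
  have hprod : 0 < K 0 * K 1 := by linarith [mul_comm (K 0) (K 1)]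
  obtain ⟨h0, h1⟩ : 0 < K 0 ∧ 0 < K 1 := by
    rcases mul_pos_iff.mp hprod with h | h <;> omega
  have hlt := mul_lt_of_form_HInt_neg h0.le h1.le hsq hH
  rw [form_HInt] at hH
  rw [hform] at hsq
  rw [ha, hb] at hlt hsq hH
  have ha1 : 1 ≤ a := by omega
  have hb1 : 1 ≤ b := by omega
  have hmul : a * b ≤ 6 := by
    rw [← two_mul, ← two_mul, mul_mul_mul_comm] at hlt
    omega
  have ha6 : a ≤ 6 := (le_mul_of_one_le_right (by omega) hb1).trans hmul
  have hb6 : b ≤ 6 := (le_mul_of_one_le_left (by omega) ha1).trans hmul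
  have hab : a = 1 ∧ b = 1 := by
    have n2 := near 2 (by decide)
    have n3 := near 3 (by decide)
    have n4 := near 4 (by decide)
    have n5 := near 5 (by decide)
    have n6 := near 6 (by decide)
    have n7 := near 7 (by decide)
    have n8 := near 8 (by decide)
    have n9 := near 9 (by decide)
    have n10 := near 10 (by decide)
    have n11 := near 11 (by decide)
    have n12 := near 12 (by decide)
    have f2 := far 2 (by decide)
    have f3 := far 3 (by decide)
    have f4 := far 4 (by decide)
    clear hodd near far sq_pos hK hform hAB hprod h0 h1 hlt
    interval_cases a <;> interval_cases b <;>
      first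
        | exact ⟨rfl, rfl⟩
        | (exfalso; norm_num at hmul; done)
        | (exfalso; ring_nf at *; linarith)
  obtain ⟨rfl, rfl⟩ := hab
  have lower (i : Fin 13) (h : K i * K i ≤ 1) : -1 ≤ K i :=
    (abs_le.mp (abs_le_one_iff_mul_self_le_one.mpr h)).1
  have l2 := lower 2 (by linarith)
  have l3 := lower 3 (by linarith)
  have l4 := lower 4 (by linarith)
  have l5 := lower 5 (by linarith)
  have l6 := lower 6 (by linarith)
  have l7 := lower 7 (by linarith)
  have l8 := lower 8 (by linarith)
  have l9 := lower 9 (by linarith)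
  have l10 := lower 10 (by linarith)
  have l11 := lower 11 (by linarith)
  have l12 := lower 12 (by linarith)
  have hneg (i : Fin 13) (hi : 2 ≤ (i : ℕ)) (h : K i ≤ 0) (l : -1 ≤ K i) : K i = -1 := by
    obtain ⟨k, hk⟩ := hodd i hi
    omega
  ext i
  fin_cases i
  · simpa [KQ] using ha
  · simpa [KQ] using hb
  all_goals exact hneg _ (by decide) (by simp; linarith) (by simp; linarith)

/-- the characteristic vectors satisfying conditions (i)–(iv) are
exactly `{K_Q, −K_Q}`. -/
theorem basic_classes_of_Q :
    {K : L' | IsCharacteristic K ∧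
      (form K R0, form K R1, form K R2, form K R3) ∈
        ({(5,0,0,0), (-1,-2,0,0), (3,0,0,-2), (-5,0,0,0), (1,0,-2,0)} :
          Set (ℤ × ℤ × ℤ × ℤ)) ∧
      (∀ i : Fin 9, |form K (S i)| ≤ -form (S i) (S i) ∧
        form K (S i) ≡ form (S i) (S i) [ZMOD 2]) ∧
      form K K ≥ -3 ∧
      ((formQ (toQ K) H > 0 ∧ form K (A + B) < 0) ∨
        (formQ (toQ K) H < 0 ∧ form K (A + B) > 0))} = {KQ, -KQ} := by
  ext K
  simp only [Set.mem_ofPred_eq, Set.mem_insert_iff, Set.mem_singleton_iff]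
  constructor
  · rintro ⟨hK, -, -, hsq, hsign⟩
    rw [formQ_toQ_H, form_A_add_B] at hsign
    rcases hsign with ⟨hH, hAB⟩ | ⟨hH, hAB⟩
    · left
      refine neg_injective (eq_neg_KQ_of_separating hK.neg ?_ ?_ ?_)
      · rwa [form_neg_left, form_neg_right, neg_neg]
      · rw [form_neg_left]
        exact neg_neg_of_pos (by exact_mod_cast hH)
      · simp only [Pi.neg_apply]
        linarith
    · exact Or.inr (eq_neg_KQ_of_separating hK hsq (by exact_mod_cast hH) hAB)
  · rintro (rfl | rfl)
    · rw [formQ_toQ_H, gt_iff_lt, Int.cast_pos, gt_iff_lt, Int.cast_lt_zero]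
      exact ⟨isCharacteristic_KQ, by decide, by decide, by decide, by decide⟩
    · rw [formQ_toQ_H, gt_iff_lt, Int.cast_pos, gt_iff_lt, Int.cast_lt_zero]
      exact ⟨isCharacteristic_KQ.neg, by decide, by decide, by decide, by decide⟩

end ParkQ
end
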